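/- Let a, b ∈ ℂ[u,v] ⊆ ℂ[x,y,u,v] be homogeneous polynomials of degree 2 having no common zero in ℂ² ∖ {0}, and let c, d, e ∈ ℂ[u,v] be homogeneous of degree 1. Let I = (a·x + b·y + c·x² + d·x·y + e·y², x³, x²·y, x·y², y³) ⊆ R = ℂ[x,y,u,v]. Then there exists a natural number N such that for all t ≥ N the Hilbert function of R/I at t equals 3t + 6. (This is the Hilbert polynomial of the unique triple structure τ on the line x = y = 0 contained in a smooth cubic surface.) -/

import Mathlib

open MvPolynomial

/-- The Hilbert function of `R ⧸ I` at `t`, for a homogeneous ideal `I` of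
`R = ℂ[x,y,u,v]`: `dim_ℂ R_t − dim_ℂ (I ∩ R_t)`. -/
noncomputable def hilbertFn (I : Ideal (MvPolynomial (Fin 4) ℂ)) (t : ℕ) : ℤ :=
  (Module.finrank ℂ (MvPolynomial.homogeneousSubmodule (Fin 4) ℂ t) : ℤ) -
    (Module.finrank ℂ
      ↥(Submodule.restrictScalars ℂ I ⊓ MvPolynomial.homogeneousSubmodule (Fin 4) ℂ t) : ℤ)

/-- Variables: `x = X 0`, `y = X 1`, `u = X 2`, `v = X 3`; `ℂ[u,v] ⊆ ℂ[x,y,u,v]`. -/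
noncomputable def embUV : MvPolynomial (Fin 2) ℂ →ₐ[ℂ] MvPolynomial (Fin 4) ℂ :=
  MvPolynomial.rename (fun i : Fin 2 => (i.succ.succ : Fin 4))

/-- The coefficient in `ℂ[u,v]` of `x ^ i * y ^ j`. -/
noncomputable def coeffXY (i j : ℕ) : MvPolynomial (Fin 4) ℂ →ₗ[ℂ] MvPolynomial (Fin 2) ℂ where
  toFun f := (finSuccEquiv ℂ 2 ((finSuccEquiv ℂ 3 f).coeff i)).coeff j
  map_add' f g := by simp
  map_smul' r f := by simp

theorem finSuccEquiv_rename_succ {R : Type*} [CommSemiring R] {n : ℕ}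
    (p : MvPolynomial (Fin n) R) :
    finSuccEquiv R n (rename Fin.succ p) = Polynomial.C p := by
  induction p using MvPolynomial.induction_on with
  | C r => simp [finSuccEquiv_apply]
  | add p q hp hq => simp [hp, hq]
  | mul_X p i hp => rw [map_mul, map_mul, hp, rename_X, finSuccEquiv_X_succ, Polynomial.C_mul]

theorem embUV_eq_rename_rename (s : MvPolynomial (Fin 2) ℂ) :
    embUV s = rename Fin.succ (rename Fin.succ s) := by
  rw [rename_rename]; rfl

theorem coeffXY_embUV_mul (i j : ℕ) (s : MvPolynomial (Fin 2) ℂ) (f : MvPolynomial (Fin 4) ℂ) :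
    coeffXY i j (embUV s * f) = s * coeffXY i j f := by
  simp only [coeffXY, LinearMap.coe_mk, AddHom.coe_mk, embUV_eq_rename_rename, map_mul,
    finSuccEquiv_rename_succ, Polynomial.coeff_C_mul]

theorem coeffXY_succ_mul_x (i j : ℕ) (f : MvPolynomial (Fin 4) ℂ) :
    coeffXY (i + 1) j (f * X 0) = coeffXY i j f := by
  simp [coeffXY, finSuccEquiv_X_zero]

theorem coeffXY_zero_mul_x (j : ℕ) (f : MvPolynomial (Fin 4) ℂ) :
    coeffXY 0 j (f * X 0) = 0 := by
  simp [coeffXY, finSuccEquiv_X_zero]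

theorem finSuccEquiv_y : finSuccEquiv ℂ 3 (X 1) = Polynomial.C (X 0) :=
  finSuccEquiv_X_succ (j := 0)

theorem coeffXY_succ_mul_y (i j : ℕ) (f : MvPolynomial (Fin 4) ℂ) :
    coeffXY i (j + 1) (f * X 1) = coeffXY i j f := by
  simp [coeffXY, finSuccEquiv_X_zero, finSuccEquiv_y]

theorem coeffXY_zero_mul_y (i : ℕ) (f : MvPolynomial (Fin 4) ℂ) :
    coeffXY i 0 (f * X 1) = 0 := by
  simp [coeffXY, finSuccEquiv_X_zero, finSuccEquiv_y]

theorem coeffXY_embUV (i j : ℕ) (s : MvPolynomial (Fin 2) ℂ) :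
    coeffXY i j (embUV s) = if i = 0 ∧ j = 0 then s else 0 := by
  rcases i with _ | i <;> rcases j with _ | j <;>
    simp [coeffXY, embUV_eq_rename_rename, finSuccEquiv_rename_succ, Polynomial.coeff_C,
      -rename_rename]

theorem isHomogeneous_coeffXY {f : MvPolynomial (Fin 4) ℂ} {t : ℕ} (hf : f.IsHomogeneous t)
    {i j k : ℕ} (h : i + j + k = t) : (coeffXY i j f).IsHomogeneous k :=
  (hf.finSuccEquiv_coeff_isHomogeneous i (j + k) (by omega)).finSuccEquiv_coeff_isHomogeneous
    j k rfl

theorem homogeneousComponent_add_mul {σ R : Type*} [CommSemiring R] {a : MvPolynomial σ R} {n : ℕ}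
    (ha : a.IsHomogeneous n) (k : ℕ) (g : MvPolynomial σ R) :
    homogeneousComponent (n + k) (a * g) = a * homogeneousComponent k g := by
  let _ : GradedAlgebra (homogeneousSubmodule σ R) := MvPolynomial.gradedAlgebra
  rw [← decomposition.decompose'_apply, ← decomposition.decompose'_apply]
  exact DirectSum.coe_decompose_mul_add_of_left_mem (homogeneousSubmodule σ R) ha

theorem Submodule.finrank_map_add_finrank_inf_ker {K V W : Type*} [Field K] [AddCommGroup V]
    [Module K V] [AddCommGroup W] [Module K W] (f : V →ₗ[K] W) (P : Submodule K V)
    [FiniteDimensional K P] :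
    Module.finrank K (P.map f) + Module.finrank K ↥(P ⊓ LinearMap.ker f) = Module.finrank K P := by
  have h := LinearMap.finrank_range_add_finrank_ker (f.domRestrict P)
  rw [LinearMap.range_domRestrict, LinearMap.ker_domRestrict] at h
  rw [← h, ← Submodule.map_comap_subtype, LinearEquiv.finrank_eq
    (Submodule.equivMapOfInjective P.subtype P.injective_subtype _)]


theorem finrank_homogeneousSubmodule_fin_two (n : ℕ) :
    Module.finrank ℂ (homogeneousSubmodule (Fin 2) ℂ n) = n + 1 := by
  have hset : {d : Fin 2 →₀ ℕ | d.degree = n} =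
      ((Finset.univ : Finset (Fin 2)).finsuppAntidiag n : Set (Fin 2 →₀ ℕ)) := by
    ext d
    simp [Finset.mem_finsuppAntidiag, Finsupp.degree_eq_sum]
  rw [homogeneousSubmodule_eq_finsupp_supported, hset,
    (AddMonoidAlgebra.supportedEquivFinsupp _).finrank_eq, Module.finrank_finsupp_self]
  simp [Finset.card_finsuppAntidiag_nat_eq_choose, Nat.add_comm]

theorem Submodule.finrank_prod_eq_add {K V W : Type*} [Field K] [AddCommGroup V]
    [Module K V] [AddCommGroup W] [Module K W] (P : Submodule K V) (Q : Submodule K W)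
    [FiniteDimensional K P] [FiniteDimensional K Q] :
    Module.finrank K (P.prod Q) = Module.finrank K P + Module.finrank K Q := by
  have h : LinearMap.range (P.subtype.prodMap Q.subtype) = P.prod Q := by
    rw [LinearMap.range_prodMap, Submodule.range_subtype, Submodule.range_subtype]
  rw [← h, LinearMap.finrank_range_of_inj, Module.finrank_prod]
  exact P.injective_subtype.prodMap Q.injective_subtype

/-- The cube of the ideal `(x, y)`. -/
noncomputable def cubeXY : Ideal (MvPolynomial (Fin 4) ℂ) :=
  Ideal.span {X 0 ^ 3, X 0 ^ 2 * X 1, X 0 * X 1 ^ 2, X 1 ^ 3}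

/-- The coefficients in `ℂ[u,v]` of `1, x, y, x², xy, y²`. -/
noncomputable def jetXY : MvPolynomial (Fin 4) ℂ →ₗ[ℂ]
    MvPolynomial (Fin 2) ℂ × MvPolynomial (Fin 2) ℂ × MvPolynomial (Fin 2) ℂ ×
      MvPolynomial (Fin 2) ℂ × MvPolynomial (Fin 2) ℂ × MvPolynomial (Fin 2) ℂ :=
  (coeffXY 0 0).prod <| (coeffXY 1 0).prod <| (coeffXY 0 1).prod <|
    (coeffXY 2 0).prod <| (coeffXY 1 1).prod (coeffXY 0 2)

/-- The polynomial `s₀ + s₁ x + s₂ y + s₃ x² + s₄ xy + s₅ y²`. -/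
noncomputable def ofJetXY (w : MvPolynomial (Fin 2) ℂ × MvPolynomial (Fin 2) ℂ ×
    MvPolynomial (Fin 2) ℂ × MvPolynomial (Fin 2) ℂ × MvPolynomial (Fin 2) ℂ ×
      MvPolynomial (Fin 2) ℂ) : MvPolynomial (Fin 4) ℂ :=
  embUV w.1 + embUV w.2.1 * X 0 + embUV w.2.2.1 * X 1 + embUV w.2.2.2.1 * X 0 ^ 2 +
    embUV w.2.2.2.2.1 * (X 0 * X 1) + embUV w.2.2.2.2.2 * X 1 ^ 2

theorem coeffXY_eq_zero_of_mem_cubeXY {f : MvPolynomial (Fin 4) ℂ} (hf : f ∈ cubeXY) {i j : ℕ}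
    (hij : i + j ≤ 2) : coeffXY i j f = 0 := by
  simp only [cubeXY, Ideal.mem_span_insert, Ideal.mem_span_singleton'] at hf
  obtain ⟨p, _, ⟨q, _, ⟨r, _, ⟨s, rfl⟩, rfl⟩, rfl⟩, rfl⟩ := hf
  have h : (i = 0 ∧ j = 0) ∨ (i = 1 ∧ j = 0) ∨ (i = 0 ∧ j = 1) ∨ (i = 2 ∧ j = 0) ∨
      (i = 1 ∧ j = 1) ∨ (i = 0 ∧ j = 2) := by omega
  rcases h with ⟨rfl, rfl⟩ | ⟨rfl, rfl⟩ | ⟨rfl, rfl⟩ | ⟨rfl, rfl⟩ | ⟨rfl, rfl⟩ | ⟨rfl, rfl⟩ <;>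
    simp [pow_succ, ← mul_assoc, coeffXY_succ_mul_x, coeffXY_zero_mul_x, coeffXY_succ_mul_y,
      coeffXY_zero_mul_y]

theorem jetXY_eq_zero_of_mem_cubeXY {f : MvPolynomial (Fin 4) ℂ} (hf : f ∈ cubeXY) :
    jetXY f = 0 := by
  simp [jetXY, coeffXY_eq_zero_of_mem_cubeXY hf]

theorem jetXY_ofJetXY (w) : jetXY (ofJetXY w) = w := by
  simp [jetXY, ofJetXY, pow_succ, ← mul_assoc, coeffXY_succ_mul_x, coeffXY_zero_mul_x,
    coeffXY_succ_mul_y, coeffXY_zero_mul_y, coeffXY_embUV]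

theorem exists_sub_ofJetXY_mem_cubeXY (f : MvPolynomial (Fin 4) ℂ) :
    ∃ w, f - ofJetXY w ∈ cubeXY := by
  have hxxx : (X 0 ^ 3 : MvPolynomial (Fin 4) ℂ) ∈ cubeXY := Ideal.subset_span (by simp)
  have hxxy : (X 0 ^ 2 * X 1 : MvPolynomial (Fin 4) ℂ) ∈ cubeXY := Ideal.subset_span (by simp)
  have hxyy : (X 0 * X 1 ^ 2 : MvPolynomial (Fin 4) ℂ) ∈ cubeXY := Ideal.subset_span (by simp)
  have hyyy : (X 1 ^ 3 : MvPolynomial (Fin 4) ℂ) ∈ cubeXY := Ideal.subset_span (by simp)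
  induction f using MvPolynomial.induction_on with
  | C r => exact ⟨(C r, 0, 0, 0, 0, 0), by simp [ofJetXY, embUV]⟩
  | add f g hf hg =>
    obtain ⟨w, hw⟩ := hf
    obtain ⟨z, hz⟩ := hg
    refine ⟨w + z, ?_⟩
    convert add_mem hw hz using 1
    simp only [ofJetXY, Prod.fst_add, Prod.snd_add, map_add]
    ring
  | mul_X f n hf =>
    obtain ⟨⟨s₀, s₁, s₂, s₃, s₄, s₅⟩, hw⟩ := hf
    have hw' := cubeXY.mul_mem_right (X n) hw
    have hu : embUV (X 0) = X 2 := by simp [embUV]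
    have hv : embUV (X 1) = X 3 := by simp [embUV]
    fin_cases n
    · refine ⟨(0, s₀, 0, s₁, s₂, 0), ?_⟩
      convert add_mem hw' (add_mem (cubeXY.mul_mem_left (embUV s₃) hxxx)
        (add_mem (cubeXY.mul_mem_left (embUV s₄) hxxy)
          (cubeXY.mul_mem_left (embUV s₅) hxyy))) using 1
      simp only [ofJetXY, map_zero, Fin.zero_eta]
      ring
    · refine ⟨(0, 0, s₀, 0, s₁, s₂), ?_⟩
      convert add_mem hw' (add_mem (cubeXY.mul_mem_left (embUV s₃) hxxy)
        (add_mem (cubeXY.mul_mem_left (embUV s₄) hxyy)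
          (cubeXY.mul_mem_left (embUV s₅) hyyy))) using 1
      simp only [ofJetXY, map_zero, Fin.mk_one]
      ring
    · refine ⟨(s₀ * X 0, s₁ * X 0, s₂ * X 0, s₃ * X 0, s₄ * X 0, s₅ * X 0), ?_⟩
      convert hw' using 1
      simp only [ofJetXY, map_mul, hu, Fin.reduceFinMk]
      ring
    · refine ⟨(s₀ * X 1, s₁ * X 1, s₂ * X 1, s₃ * X 1, s₄ * X 1, s₅ * X 1), ?_⟩
      convert hw' using 1
      simp only [ofJetXY, map_mul, hv, Fin.reduceFinMk]
      ring

theorem mem_cubeXY_of_jetXY_eq_zero {f : MvPolynomial (Fin 4) ℂ} (hf : jetXY f = 0) :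
    f ∈ cubeXY := by
  obtain ⟨w, hw⟩ := exists_sub_ofJetXY_mem_cubeXY f
  have h := jetXY_eq_zero_of_mem_cubeXY hw
  rw [map_sub, hf, jetXY_ofJetXY, zero_sub, neg_eq_zero] at h
  subst h
  simpa [ofJetXY] using hw

/-- The jets of homogeneous polynomials of degree `s + 4`. -/
noncomputable def homogeneousJets (s : ℕ) := (homogeneousSubmodule (Fin 2) ℂ (s + 4)).prod <|
  (homogeneousSubmodule (Fin 2) ℂ (s + 3)).prod <| (homogeneousSubmodule (Fin 2) ℂ (s + 3)).prod <|
  (homogeneousSubmodule (Fin 2) ℂ (s + 2)).prod <| (homogeneousSubmodule (Fin 2) ℂ (s + 2)).prod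
  (homogeneousSubmodule (Fin 2) ℂ (s + 2))

theorem isHomogeneous_embUV {s : MvPolynomial (Fin 2) ℂ} {n : ℕ} (hs : s.IsHomogeneous n) :
    (embUV s).IsHomogeneous n :=
  hs.rename_isHomogeneous

theorem isHomogeneous_ofJetXY {s : ℕ} {w} (hw : w ∈ homogeneousJets s) :
    (ofJetXY w).IsHomogeneous (s + 4) := by
  obtain ⟨h₀, h₁, h₂, h₃, h₄, h₅⟩ := hw
  have hx := isHomogeneous_X ℂ (0 : Fin 4)
  have hy := isHomogeneous_X ℂ (1 : Fin 4)
  exact (((((isHomogeneous_embUV h₀).add ((isHomogeneous_embUV h₁).mul hx)).add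
    ((isHomogeneous_embUV h₂).mul hy)).add ((isHomogeneous_embUV h₃).mul (hx.pow 2))).add
    ((isHomogeneous_embUV h₄).mul (hx.mul hy))).add ((isHomogeneous_embUV h₅).mul (hy.pow 2))

theorem map_jetXY_homogeneousSubmodule (s : ℕ) :
    (homogeneousSubmodule (Fin 4) ℂ (s + 4)).map jetXY = homogeneousJets s := by
  ext w
  constructor
  · rintro ⟨f, hf, rfl⟩
    refine ⟨?_, ?_, ?_, ?_, ?_, ?_⟩ <;> exact isHomogeneous_coeffXY hf (by omega)
  · exact fun hw => ⟨ofJetXY w, isHomogeneous_ofJetXY hw, jetXY_ofJetXY w⟩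

instance finiteDimensional_homogeneousSubmodule {σ : Type*} [Finite σ] (n : ℕ) :
    FiniteDimensional ℂ (homogeneousSubmodule σ ℂ n) :=
  Module.Finite.iff_fg.mpr (homogeneousSubmodule_fg σ ℂ n)

instance Submodule.finiteDimensional_prod {K V W : Type*} [Field K] [AddCommGroup V]
    [Module K V] [AddCommGroup W] [Module K W] (P : Submodule K V) (Q : Submodule K W)
    [FiniteDimensional K P] [FiniteDimensional K Q] : FiniteDimensional K (P.prod Q) :=
  Module.Finite.iff_fg.mpr (Submodule.FG.prod (Module.Finite.iff_fg.mp ‹_›)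
    (Module.Finite.iff_fg.mp ‹_›))

theorem finrank_homogeneousJets (s : ℕ) : Module.finrank ℂ (homogeneousJets s) = 6 * s + 22 := by
  unfold homogeneousJets
  iterate 5 rw [Submodule.finrank_prod_eq_add]
  simp only [finrank_homogeneousSubmodule_fin_two]
  omega

/-- The jet of `(g + p x + q y) * (a x + b y + c x² + d xy + e y²)`. -/
noncomputable def tripleJet (a b c d e : MvPolynomial (Fin 2) ℂ) :
    MvPolynomial (Fin 2) ℂ × MvPolynomial (Fin 2) ℂ × MvPolynomial (Fin 2) ℂ →ₗ[ℂ]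
    MvPolynomial (Fin 2) ℂ × MvPolynomial (Fin 2) ℂ × MvPolynomial (Fin 2) ℂ ×
      MvPolynomial (Fin 2) ℂ × MvPolynomial (Fin 2) ℂ × MvPolynomial (Fin 2) ℂ where
  toFun w := (0, a * w.1, b * w.1, a * w.2.1 + c * w.1, a * w.2.2 + b * w.2.1 + d * w.1,
    b * w.2.2 + e * w.1)
  map_add' w z := by 
    simp only [Prod.fst_add, Prod.snd_add, Prod.mk_add_mk, Prod.mk.injEq, add_zero, true_and]
    refine ⟨?_, ?_, ?_, ?_, ?_⟩ <;> ring
  map_smul' r w := by simp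

theorem tripleJet_injective {a b c d e : MvPolynomial (Fin 2) ℂ} (hab : a ≠ 0 ∨ b ≠ 0) :
    Function.Injective (tripleJet a b c d e) := by
  rw [← LinearMap.ker_eq_bot, LinearMap.ker_eq_bot']
  rintro ⟨g, p, q⟩ h
  simp only [tripleJet, LinearMap.coe_mk, AddHom.coe_mk, Prod.mk_eq_zero, true_and] at h
  obtain ⟨h₁, h₂, h₃, h₄, h₅⟩ := h
  rcases hab with h | h
  · obtain rfl : g = 0 := by simpa [h] using h₁
    obtain rfl : p = 0 := by simpa [h] using h₃
    obtain rfl : q = 0 := by simpa [h] using h₄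
    rfl
  · obtain rfl : g = 0 := by simpa [h] using h₂
    obtain rfl : q = 0 := by simpa [h] using h₅
    obtain rfl : p = 0 := by simpa [h] using h₄
    rfl

theorem jetXY_mul (a b c d e : MvPolynomial (Fin 2) ℂ) (h : MvPolynomial (Fin 4) ℂ) :
    jetXY (h * (embUV a * X 0 + embUV b * X 1 +
          embUV c * X 0 ^ 2 + embUV d * (X 0 * X 1) + embUV e * X 1 ^ 2)) =
      tripleJet a b c d e (coeffXY 0 0 h, coeffXY 1 0 h, coeffXY 0 1 h) := by
  have hF : h * (embUV a * X 0 + embUV b * X 1 +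
      embUV c * X 0 ^ 2 + embUV d * (X 0 * X 1) + embUV e * X 1 ^ 2) =
      embUV a * (h * X 0) + embUV b * (h * X 1) + embUV c * (h * X 0 * X 0) +
        embUV d * (h * X 0 * X 1) + embUV e * (h * X 1 * X 1) := by ring
  rw [hF]
  simp [jetXY, tripleJet, coeffXY_embUV_mul, coeffXY_succ_mul_x, coeffXY_zero_mul_x,
    coeffXY_succ_mul_y, coeffXY_zero_mul_y]

theorem map_jetXY_span_inf_homogeneousSubmodule {a b c d e : MvPolynomial (Fin 2) ℂ}
    (ha : a.IsHomogeneous 2) (hb : b.IsHomogeneous 2)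
    (hc : c.IsHomogeneous 1) (hd : d.IsHomogeneous 1) (he : e.IsHomogeneous 1) (s : ℕ) :
    (Submodule.restrictScalars ℂ (Ideal.span
        {embUV a * X 0 + embUV b * X 1 +
          embUV c * X 0 ^ 2 + embUV d * (X 0 * X 1) + embUV e * X 1 ^ 2,
         X 0 ^ 3, X 0 ^ 2 * X 1, X 0 * X 1 ^ 2, X 1 ^ 3}) ⊓
      homogeneousSubmodule (Fin 4) ℂ (s + 4)).map jetXY =
    ((homogeneousSubmodule (Fin 2) ℂ (s + 1)).prod ((homogeneousSubmodule (Fin 2) ℂ s).prod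
      (homogeneousSubmodule (Fin 2) ℂ s))).map (tripleJet a b c d e) := by
  ext w
  constructor
  · rintro ⟨f, ⟨hfI, hf⟩, rfl⟩
    obtain ⟨h, r, hr, rfl⟩ := Ideal.mem_span_insert.mp hfI
    have hjet := map_add jetXY (h * (embUV a * X 0 + embUV b * X 1 +
      embUV c * X 0 ^ 2 + embUV d * (X 0 * X 1) + embUV e * X 1 ^ 2)) r
    rw [jetXY_eq_zero_of_mem_cubeXY hr, add_zero, jetXY_mul] at hjet
    have hw := (map_jetXY_homogeneousSubmodule s).le (Submodule.mem_map_of_mem hf)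
    rw [hjet] at hw ⊢
    generalize coeffXY 0 0 h = g, coeffXY 1 0 h = p, coeffXY 0 1 h = q at hw ⊢
    obtain ⟨-, h₁, h₂, h₃, h₄, h₅⟩ := hw
    refine ⟨(homogeneousComponent (s + 1) g, homogeneousComponent s p, homogeneousComponent s q),
      ⟨homogeneousComponent_mem _ _, homogeneousComponent_mem _ _, homogeneousComponent_mem _ _⟩,
      ?_⟩
    have comp : ∀ {n k m : ℕ} {f : MvPolynomial (Fin 2) ℂ}, f.IsHomogeneous n → n + k = m →
        ∀ z, f * homogeneousComponent k z = homogeneousComponent m (f * z) := by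
      rintro n k _ f hf rfl z
      exact (homogeneousComponent_add_mul hf k z).symm
    simp only [tripleJet, LinearMap.coe_mk, AddHom.coe_mk, Prod.mk.injEq, true_and]
    refine ⟨?_, ?_, ?_, ?_, ?_⟩
    · rw [comp ha (m := s + 3) (by omega)]
      exact homogeneousComponent_eq_self h₁
    · rw [comp hb (m := s + 3) (by omega)]
      exact homogeneousComponent_eq_self h₂
    · rw [comp ha (m := s + 2) (by omega), comp hc (m := s + 2) (by omega), ← map_add]
      exact homogeneousComponent_eq_self h₃
    · rw [comp ha (m := s + 2) (by omega), comp hb (m := s + 2) (by omega),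
        comp hd (m := s + 2) (by omega), ← map_add, ← map_add]
      exact homogeneousComponent_eq_self h₄
    · rw [comp hb (m := s + 2) (by omega), comp he (m := s + 2) (by omega), ← map_add]
      exact homogeneousComponent_eq_self h₅
  · rintro ⟨⟨g, p, q⟩, ⟨hg, hp, hq⟩, rfl⟩
    have hx := isHomogeneous_X ℂ (0 : Fin 4)
    have hy := isHomogeneous_X ℂ (1 : Fin 4)
    have hh : (embUV g + embUV p * X 0 + embUV q * X 1).IsHomogeneous (s + 1) :=
      ((isHomogeneous_embUV hg).add ((isHomogeneous_embUV hp).mul hx)).add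
        ((isHomogeneous_embUV hq).mul hy)
    have hF : (embUV a * X 0 + embUV b * X 1 + embUV c * X 0 ^ 2 + embUV d * (X 0 * X 1) +
        embUV e * X 1 ^ 2).IsHomogeneous 3 :=
      (((((isHomogeneous_embUV ha).mul hx).add ((isHomogeneous_embUV hb).mul hy)).add
        ((isHomogeneous_embUV hc).mul (hx.pow 2))).add
        ((isHomogeneous_embUV hd).mul (hx.mul hy))).add ((isHomogeneous_embUV he).mul (hy.pow 2))
    refine ⟨_, ⟨Ideal.mul_mem_left _ (embUV g + embUV p * X 0 + embUV q * X 1)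
      (Ideal.subset_span (Set.mem_insert _ _)), hh.mul hF⟩, ?_⟩
    rw [jetXY_mul]
    have hjet := jetXY_ofJetXY (g, p, q, 0, 0, 0)
    simp only [ofJetXY, map_zero, zero_mul, add_zero, jetXY, LinearMap.prod_apply,
      Function.prod_apply, Prod.mk.injEq] at hjet
    rw [hjet.1, hjet.2.1, hjet.2.2.1]

theorem triple_line_hilbert_polynomial
    (a b c d e : MvPolynomial (Fin 2) ℂ)
    (ha : a.IsHomogeneous 2) (hb : b.IsHomogeneous 2)
    (hc : c.IsHomogeneous 1) (hd : d.IsHomogeneous 1) (he : e.IsHomogeneous 1)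
    (hab : ∀ p : Fin 2 → ℂ, p ≠ 0 → ¬(eval p a = 0 ∧ eval p b = 0)) :
    ∃ N : ℕ, ∀ t : ℕ, N ≤ t →
      hilbertFn (Ideal.span
        {embUV a * X 0 + embUV b * X 1 +
          embUV c * X 0 ^ 2 + embUV d * (X 0 * X 1) + embUV e * X 1 ^ 2,
         X 0 ^ 3, X 0 ^ 2 * X 1, X 0 * X 1 ^ 2, X 1 ^ 3}) t
        = 3 * (t : ℤ) + 6 := by
  have hab' : a ≠ 0 ∨ b ≠ 0 := by
    by_contra! h
    exact hab 1 one_ne_zero (by simp [h])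
  refine ⟨4, fun t ht => ?_⟩
  obtain ⟨s, rfl⟩ := Nat.exists_eq_add_of_le' ht
  have hmap := map_jetXY_span_inf_homogeneousSubmodule ha hb hc hd he s
  unfold hilbertFn
  generalize hI : (Ideal.span _ : Ideal (MvPolynomial (Fin 4) ℂ)) = I at hmap ⊢
  have hker : LinearMap.ker jetXY ≤ Submodule.restrictScalars ℂ I := fun f hf => by
    rw [← hI]
    exact Ideal.span_mono (Set.subset_insert _ _) (mem_cubeXY_of_jetXY_eq_zero hf)
  have : FiniteDimensional ℂ ↥(Submodule.restrictScalars ℂ I ⊓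
      homogeneousSubmodule (Fin 4) ℂ (s + 4)) :=
    Submodule.finiteDimensional_of_le inf_le_right
  have hR := Submodule.finrank_map_add_finrank_inf_ker jetXY
    (homogeneousSubmodule (Fin 4) ℂ (s + 4))
  have hS := Submodule.finrank_map_add_finrank_inf_ker jetXY
    (Submodule.restrictScalars ℂ I ⊓ homogeneousSubmodule (Fin 4) ℂ (s + 4))
  rw [inf_right_comm, inf_eq_right.mpr hker, inf_comm (LinearMap.ker jetXY), hmap,
    ← (Submodule.equivMapOfInjective _ (tripleJet_injective hab') _).finrank_eq,
    Submodule.finrank_prod_eq_add, Submodule.finrank_prod_eq_add,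
    finrank_homogeneousSubmodule_fin_two, finrank_homogeneousSubmodule_fin_two] at hS
  rw [map_jetXY_homogeneousSubmodule, finrank_homogeneousJets] at hR
  push_cast
  omega
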